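/- For all real numbers δ > 0 and 0 < y₁ < y₂, the inequality log(y₂/y₁) ≤ 2·log(1 + √(2δ/y₁)) holds if and only if (y₁ + y₂)/2 − √(y₁·y₂) ≤ δ (equivalently, if and only if (√y₂ − √y₁)² ≤ 2δ). -/

import Mathlib

open Real

/-- For `δ > 0` and `0 < y₁ < y₂`: `log (y₂/y₁) ≤ 2 log (1 + √(2δ/y₁))` iff
`(y₁ + y₂)/2 - √(y₁ y₂) ≤ δ`. -/
theorem log_ratio_le_iff_horoball_misses_geodesic (δ y₁ y₂ : ℝ) (hδ : 0 < δ)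
    (h0 : 0 < y₁) (h12 : y₁ < y₂) :
    Real.log (y₂ / y₁) ≤ 2 * Real.log (1 + Real.sqrt (2 * δ / y₁)) ↔
      (y₁ + y₂) / 2 - Real.sqrt (y₁ * y₂) ≤ δ := by
  have h2 : 0 < y₂ := h0.trans h12
  have ha : 0 < √y₁ := Real.sqrt_pos.mpr h0
  have hab : √y₁ < √y₂ := Real.sqrt_lt_sqrt h0.le h12
  have hsq : (√y₂ - √y₁) ^ 2 = y₁ + y₂ - 2 * √(y₁ * y₂) := by
    rw [Real.sqrt_mul h0.le, sub_sq, Real.sq_sqrt h0.le, Real.sq_sqrt h2.le]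
    ring
  calc Real.log (y₂ / y₁) ≤ 2 * Real.log (1 + √(2 * δ / y₁))
      ↔ Real.log (y₂ / y₁) ≤ Real.log ((1 + √(2 * δ / y₁)) ^ 2) := by
        rw [Real.log_pow, Nat.cast_ofNat]
    _ ↔ y₂ / y₁ ≤ (1 + √(2 * δ / y₁)) ^ 2 :=
        Real.log_le_log_iff (div_pos h2 h0) (by positivity)
    _ ↔ √y₂ / √y₁ ≤ 1 + √(2 * δ) / √y₁ := by
        rw [← Real.sqrt_le_left (by positivity), Real.sqrt_div h2.le,
          Real.sqrt_div (by positivity)]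
    _ ↔ √y₂ - √y₁ ≤ √(2 * δ) := by
        rw [one_add_div ha.ne', div_le_div_iff_of_pos_right ha, sub_le_iff_le_add']
    _ ↔ (√y₂ - √y₁) ^ 2 ≤ 2 * δ := Real.le_sqrt' (sub_pos.mpr hab)
    _ ↔ (y₁ + y₂) / 2 - √(y₁ * y₂) ≤ δ := by
        rw [hsq]
        constructor <;> intro h <;> linarith
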